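/- arXiv:0712.2408 — 2 statements merged into one kernel-verified Lean document; each statement's English description precedes it below -/
import Mathlib

section
/- Let s ≠ t be real numbers such that T_3(s) = T_3(t), where T_3(2cos θ) = 2cos(3θ). Then for every positive integer k, (T_k(t) - T_k(s))/(t - s) = (2/√3) · sin(kπ/3) · V_{k-1}(s + t), where T_k and V_k are the monic Chebyshev polynomials of the first and second kind. -/
/-- Monic Chebyshev polynomial of the first kind: `Tm n (2 cos θ) = 2 cos (n θ)`. -/
noncomputable def Tm (n : ℤ) (x : ℝ) : ℝ := 2 * (Polynomial.Chebyshev.T ℝ n).eval (x / 2)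

/-- Monic Chebyshev polynomial of the second kind:
`Vm n (2 cos θ) = sin ((n+1) θ) / sin θ`. -/
noncomputable def Vm (n : ℤ) (x : ℝ) : ℝ := (Polynomial.Chebyshev.U ℝ n).eval (x / 2)

theorem Tm_add_two (n : ℤ) (x : ℝ) : Tm (n + 2) x = x * Tm (n + 1) x - Tm n x := by
  simp only [Tm, Polynomial.Chebyshev.T_add_two, Polynomial.eval_sub, Polynomial.eval_mul,
    Polynomial.eval_ofNat, Polynomial.eval_X]
  ring

theorem Vm_add_two (n : ℤ) (x : ℝ) : Vm (n + 2) x = x * Vm (n + 1) x - Vm n x := by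
  simp only [Vm, Polynomial.Chebyshev.U_add_two, Polynomial.eval_sub, Polynomial.eval_mul,
    Polynomial.eval_ofNat, Polynomial.eval_X]
  ring

theorem Tm_zero (x : ℝ) : Tm 0 x = 2 := by simp [Tm]

theorem Tm_one (x : ℝ) : Tm 1 x = x := by simp [Tm]; ring

theorem Vm_neg_one (x : ℝ) : Vm (-1) x = 0 := by simp [Vm]

theorem Vm_zero (x : ℝ) : Vm 0 x = 1 := by simp [Vm]

theorem sin_mul_pi_div_three_add_two (x : ℝ) :
    Real.sin ((x + 2) * Real.pi / 3) =
      Real.sin ((x + 1) * Real.pi / 3) - Real.sin (x * Real.pi / 3) := by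
  rw [show (x + 2) * Real.pi / 3 = (x + 1) * Real.pi / 3 + Real.pi / 3 by ring,
    show x * Real.pi / 3 = (x + 1) * Real.pi / 3 - Real.pi / 3 by ring,
    Real.sin_add, Real.sin_sub, Real.cos_pi_div_three]
  ring

/-- If `a`, `b`, `c`, `w` satisfy the second order recurrences with middle coefficients `t`, `s`,
`1`, `s + t`, where `s ^ 2 + s * t + t ^ 2 = 3`, then `a - b` and `c * w` satisfy the same fourth
order recurrence, so they are proportional once their initial values are. -/
theorem sub_eq_mul_of_recurrence {s t : ℝ} (h : s ^ 2 + s * t + t ^ 2 = 3) {a b c w : ℕ → ℝ}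
    (ha : ∀ n, a (n + 2) = t * a (n + 1) - a n) (hb : ∀ n, b (n + 2) = s * b (n + 1) - b n)
    (hc : ∀ n, c (n + 2) = c (n + 1) - c n) (hw : ∀ n, w (n + 2) = (s + t) * w (n + 1) - w n)
    (a0 : a 0 = 2) (a1 : a 1 = t) (b0 : b 0 = 2) (b1 : b 1 = s) (c0 : c 0 = 0) (c1 : c 1 = 1)
    (w0 : w 0 = 0) (w1 : w 1 = 1) (n : ℕ) : a n - b n = (t - s) * (c n * w n) := by
  have key : ∀ d : ℕ → ℝ, (∀ n, d (n + 4) = (s + t) * d (n + 3) - (s * t + 2) * d (n + 2)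
      + (s + t) * d (n + 1) - d n) → d 0 = 0 → d 1 = 0 → d 2 = 0 → d 3 = 0 → ∀ n, d n = 0 := by
    intro d hd h0 h1 h2 h3 n
    have : d n = 0 ∧ d (n + 1) = 0 ∧ d (n + 2) = 0 ∧ d (n + 3) = 0 := by
      induction n with
      | zero => exact ⟨h0, h1, h2, h3⟩
      | succ n ih =>
        obtain ⟨i0, i1, i2, i3⟩ := ih
        exact ⟨i1, i2, i3, by rw [hd, i0, i1, i2, i3]; ring⟩
    exact this.1
  have a2 : a 2 = t * a 1 - a 0 := ha 0
  have a3 : a 3 = t * a 2 - a 1 := ha 1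
  have b2 : b 2 = s * b 1 - b 0 := hb 0
  have b3 : b 3 = s * b 2 - b 1 := hb 1
  have c2 : c 2 = c 1 - c 0 := hc 0
  have c3 : c 3 = c 2 - c 1 := hc 1
  have w2 : w 2 = (s + t) * w 1 - w 0 := hw 0
  refine sub_eq_zero.mp (key (fun n => a n - b n - (t - s) * (c n * w n)) ?_ ?_ ?_ ?_ ?_ n)
  · intro n
    have hst : s * t = (s + t) ^ 2 - 3 := by linear_combination -h
    have ea : a (n + 4) = (s + t) * a (n + 3) - (s * t + 2) * a (n + 2)
        + (s + t) * a (n + 1) - a n := by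
      rw [ha (n + 2), ha (n + 1), ha n]; ring
    have eb : b (n + 4) = (s + t) * b (n + 3) - (s * t + 2) * b (n + 2)
        + (s + t) * b (n + 1) - b n := by
      rw [hb (n + 2), hb (n + 1), hb n]; ring
    have ec : c (n + 4) * w (n + 4) = (s + t) * (c (n + 3) * w (n + 3))
        - (s * t + 2) * (c (n + 2) * w (n + 2)) + (s + t) * (c (n + 1) * w (n + 1))
        - c n * w n := by
      rw [hst, hc (n + 2), hc (n + 1), hc n, hw (n + 2), hw (n + 1), hw n]; ring
    linear_combination ea - eb - (t - s) * ec
  · simp [a0, b0, c0]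
  · simp [a1, b1, c1, w1]
  · simp only [a2, b2, c2, w2, a1, b1, c1, w1, a0, b0, c0, w0]; ring
  · simp only [a3, b3, c3, a2, b2, c2, a1, b1, c1, a0, b0, c0]
    linear_combination (t - s) * h

theorem stmt_2 (s t : ℝ) (hst : s ≠ t) (h3 : Tm 3 s = Tm 3 t) (k : ℕ) (hk : 0 < k) :
    (Tm k t - Tm k s) / (t - s) =
      2 / Real.sqrt 3 * Real.sin (k * Real.pi / 3) * Vm ((k : ℤ) - 1) (s + t) := by
  have hts : t - s ≠ 0 := sub_ne_zero.mpr hst.symm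
  have T3 (x : ℝ) : Tm 3 x = x ^ 3 - 3 * x := by
    have e3 := Tm_add_two 1 x
    have e2 := Tm_add_two 0 x
    norm_num [Tm_zero, Tm_one] at e3 e2
    rw [e3, e2]; ring
  have h : s ^ 2 + s * t + t ^ 2 = 3 := by
    rw [T3, T3] at h3
    apply mul_left_cancel₀ hts
    linear_combination -h3
  have main := sub_eq_mul_of_recurrence h (a := fun n => Tm n t) (b := fun n => Tm n s)
    (c := fun n => 2 / Real.sqrt 3 * Real.sin (n * Real.pi / 3))
    (w := fun n => Vm ((n : ℤ) - 1) (s + t))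
    (fun n => by exact_mod_cast Tm_add_two n t) (fun n => by exact_mod_cast Tm_add_two n s)
    (fun n => by push_cast; rw [sin_mul_pi_div_three_add_two]; ring)
    (fun n => by
      have := Vm_add_two ((n : ℤ) - 1) (s + t)
      push_cast
      convert this using 3 <;> ring_nf)
    (by simp [Tm_zero]) (by simp [Tm_one]) (by simp [Tm_zero]) (by simp [Tm_one])
    (by simp) (by simp [Real.sin_pi_div_three]) (by simp [Vm_neg_one]) (by simp [Vm_zero]) k
  rw [div_eq_iff hts, main]
  ring
end

section
/- Define the sequence φ_1 = 4/9 and φ_{n+1} = (2/9)·((3n+1)(3n-1))/((n+1)(2n+1))·φ_n for n ≥ 1. Then for u ∈ [0, 1), the power series Σ_{n≥1} φ_n u^n converges to 4·sin²((1/3)·arcsin(√u)). -/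
/-- The coefficient sequence: `φ_1 = 4/9`,
`φ_{n+1} = (2/9)·((3n+1)(3n-1))/((n+1)(2n+1))·φ_n` for `n ≥ 1` (and `φ_0 = 0`). -/
noncomputable def phiSeq : ℕ → ℝ
  | 0 => 0
  | 1 => 4 / 9
  | (n + 2) =>
      (2 / 9) * ((3 * ((n : ℝ) + 1) + 1) * (3 * ((n : ℝ) + 1) - 1))
        / ((((n : ℝ) + 1) + 1) * (2 * ((n : ℝ) + 1) + 1)) * phiSeq (n + 1)

theorem summable_succ_pow_mul_geometric (k : ℕ) {r : ℝ} (hr0 : 0 < r) (hr1 : r < 1) :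
    Summable (fun n : ℕ => ((n : ℝ) + 1) ^ k * r ^ n) := by
  have h : Summable (fun n : ℕ => (n : ℝ) ^ k * r ^ n) :=
    summable_pow_mul_geometric_of_norm_lt_one k (by rwa [Real.norm_eq_abs, abs_of_pos hr0])
  have h' := ((summable_nat_add_iff 1).2 h).mul_left r⁻¹
  refine h'.congr fun n => ?_
  push_cast
  field_simp
  ring

theorem summable_mul_pow_of_abs_le {a : ℕ → ℝ} {C : ℝ} {k : ℕ}
    (ha : ∀ n, |a n| ≤ C * ((n : ℝ) + 1) ^ k) {x : ℝ} (hx : |x| < 1) :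
    Summable (fun n : ℕ => a n * x ^ n) := by
  obtain ⟨r, hxr, hr1⟩ := exists_between hx
  have hr0 : 0 < r := (abs_nonneg x).trans_lt hxr
  refine Summable.of_norm_bounded
    ((summable_succ_pow_mul_geometric k hr0 hr1).mul_left C) fun n => ?_
  rw [Real.norm_eq_abs, abs_mul, abs_pow, ← mul_assoc]
  exact mul_le_mul (ha n) (pow_le_pow_left₀ (abs_nonneg x) hxr.le n) (by positivity)
    ((abs_nonneg _).trans (ha n))

theorem hasDerivAt_tsum_mul_pow {a : ℕ → ℝ} {C : ℝ} {k : ℕ}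
    (ha : ∀ n, |a n| ≤ C * ((n : ℝ) + 1) ^ k) {x : ℝ} (hx : |x| < 1) :
    HasDerivAt (fun y => ∑' n : ℕ, a n * y ^ n)
      (∑' n : ℕ, ((n : ℝ) + 1) * a (n + 1) * x ^ n) x := by
  obtain ⟨r, hxr, hr1⟩ := exists_between hx
  have hr0 : 0 < r := (abs_nonneg x).trans_lt hxr
  have hC : ∀ n : ℕ, 0 ≤ C * ((n : ℝ) + 1) ^ k := fun n => (abs_nonneg _).trans (ha n)
  have hbound : Summable (fun n : ℕ => (r⁻¹ * C) * (((n : ℝ) + 1) ^ (k + 1) * r ^ n)) :=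
    (summable_succ_pow_mul_geometric (k + 1) hr0 hr1).mul_left _
  have hle : ∀ n : ℕ, ∀ y ∈ Metric.ball (0 : ℝ) r,
      ‖a n * ((n : ℝ) * y ^ (n - 1))‖ ≤ (r⁻¹ * C) * (((n : ℝ) + 1) ^ (k + 1) * r ^ n) := by
    intro n y hy
    have hy' : |y| ≤ r := by simpa using (mem_ball_zero_iff.1 hy).le
    rcases n with _ | m
    · have := hC 0
      have hC0 : 0 ≤ C := by simpa using this
      simpa using mul_nonneg (inv_pos.2 hr0).le hC0
    · rw [Real.norm_eq_abs, abs_mul, abs_mul, abs_pow, Nat.abs_cast]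
      have h1 := ha (m + 1)
      have h2 : |y| ^ m ≤ r ^ m := pow_le_pow_left₀ (abs_nonneg y) hy' m
      have h3 : ((m + 1 : ℕ) : ℝ) * |y| ^ m ≤ (((m + 1 : ℕ) : ℝ) + 1) * r ^ m := by
        gcongr
        linarith
      calc |a (m + 1)| * (((m + 1 : ℕ) : ℝ) * |y| ^ m)
          ≤ (C * (((m + 1 : ℕ) : ℝ) + 1) ^ k) * ((((m + 1 : ℕ) : ℝ) + 1) * r ^ m) :=
            mul_le_mul h1 h3 (by positivity) (hC _)
        _ = _ := by
            rw [pow_succ r m]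
            field_simp
            ring
  have hmem : x ∈ Metric.ball (0 : ℝ) r := by simpa using hxr
  have hder := hasDerivAt_tsum_of_isPreconnected (g := fun n y => a n * y ^ n)
    (g' := fun n y => a n * ((n : ℝ) * y ^ (n - 1))) hbound Metric.isOpen_ball
    (convex_ball (0 : ℝ) r).isPreconnected
    (fun n y _ => (hasDerivAt_pow n y).const_mul (a n)) hle hmem
    (summable_mul_pow_of_abs_le ha hx) hmem
  have hs : Summable (fun n : ℕ => a n * ((n : ℝ) * x ^ (n - 1))) :=
    Summable.of_norm_bounded hbound fun n => hle n x hmem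
  rw [hs.tsum_eq_zero_add] at hder
  simp only [Nat.cast_zero, zero_mul, mul_zero, zero_add] at hder
  refine hder.congr_deriv ?_
  refine tsum_congr fun n => ?_
  rw [Nat.add_sub_cancel]
  push_cast
  ring

theorem HasSum.mul_pow_shift {b : ℕ → ℝ} {x s : ℝ}
    (h : HasSum (fun n : ℕ => b (n + 1) * x ^ n) s) (hb : b 0 = 0) :
    HasSum (fun n : ℕ => b n * x ^ n) (x * s) := by
  rw [← hasSum_nat_add_iff' 1]
  simp only [Finset.sum_range_one, hb, zero_mul, sub_zero, pow_succ', mul_left_comm _ x]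
  exact h.mul_left x

theorem phiSeq_recurrence (n : ℕ) :
    ((n : ℝ) + 1) * (4 * n + 2) * phiSeq (n + 1)
      = 4 / 9 * (9 * (n : ℝ) ^ 2 - 1) * phiSeq n + if n = 0 then 8 / 9 else 0 := by
  rcases n with _ | n
  · norm_num [phiSeq]
  · rw [phiSeq]
    push_cast
    have h1 : (n : ℝ) + 1 + 1 ≠ 0 := by positivity
    have h2 : 2 * ((n : ℝ) + 1) + 1 ≠ 0 := by positivity
    field_simp
    ring

theorem phiSeq_succ_mem_Icc (n : ℕ) : phiSeq (n + 1) ∈ Set.Icc (0 : ℝ) 1 := by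
  induction n with
  | zero => norm_num [phiSeq]
  | succ n ih =>
    obtain ⟨h0, h1⟩ := ih
    have hn : (0 : ℝ) ≤ n := n.cast_nonneg
    have hnum : 0 ≤ (2 / 9) * ((3 * ((n : ℝ) + 1) + 1) * (3 * ((n : ℝ) + 1) - 1)) := by
      have : 0 ≤ 3 * ((n : ℝ) + 1) - 1 := by linarith
      positivity
    rw [phiSeq]
    constructor
    · positivity
    · refine mul_le_one₀ ?_ h0 h1
      rw [div_le_one (by positivity)]
      nlinarith

theorem abs_phiSeq_le (n : ℕ) : |phiSeq n| ≤ 1 := by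
  rcases n with _ | n
  · simp [phiSeq]
  · have h := phiSeq_succ_mem_Icc n
    rw [abs_of_nonneg h.1]
    exact h.2

theorem phiSeq_coeff_bound (n : ℕ) : |phiSeq n| ≤ 1 * ((n : ℝ) + 1) ^ 0 := by
  simpa using abs_phiSeq_le n

theorem phiSeq_deriv_coeff_bound (n : ℕ) :
    |((n : ℝ) + 1) * phiSeq (n + 1)| ≤ 1 * ((n : ℝ) + 1) ^ 1 := by
  rw [abs_mul, abs_of_pos (by positivity : (0 : ℝ) < n + 1)]
  have := abs_phiSeq_le (n + 1)
  have hn : (0 : ℝ) ≤ n := n.cast_nonneg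
  nlinarith

theorem phiSeq_deriv_two_coeff_bound (n : ℕ) :
    |((n : ℝ) + 1) * ((((n + 1 : ℕ) : ℝ) + 1) * phiSeq (n + 1 + 1))|
      ≤ 2 * ((n : ℝ) + 1) ^ 2 := by
  have h := phiSeq_deriv_coeff_bound (n + 1)
  rw [abs_mul, abs_of_pos (by positivity : (0 : ℝ) < n + 1)]
  have hn : (0 : ℝ) ≤ n := n.cast_nonneg
  calc _ ≤ ((n : ℝ) + 1) * (1 * (((n + 1 : ℕ) : ℝ) + 1) ^ 1) := by gcongr
    _ ≤ _ := by push_cast; nlinarith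

/-- The generating function of `phiSeq`. -/
noncomputable def phiGen (x : ℝ) : ℝ := ∑' n : ℕ, phiSeq n * x ^ n

/-- The termwise derivative of `phiGen`. -/
noncomputable def phiGenDeriv (x : ℝ) : ℝ := ∑' n : ℕ, ((n : ℝ) + 1) * phiSeq (n + 1) * x ^ n

/-- The termwise second derivative of `phiGen`. -/
noncomputable def phiGenDerivTwo (x : ℝ) : ℝ :=
  ∑' n : ℕ, ((n : ℝ) + 1) * ((((n + 1 : ℕ) : ℝ) + 1) * phiSeq (n + 1 + 1)) * x ^ n

theorem hasDerivAt_phiGen {x : ℝ} (hx : |x| < 1) : HasDerivAt phiGen (phiGenDeriv x) x :=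
  hasDerivAt_tsum_mul_pow phiSeq_coeff_bound hx

theorem hasDerivAt_phiGenDeriv {x : ℝ} (hx : |x| < 1) :
    HasDerivAt phiGenDeriv (phiGenDerivTwo x) x :=
  hasDerivAt_tsum_mul_pow (a := fun n => ((n : ℝ) + 1) * phiSeq (n + 1))
    phiSeq_deriv_coeff_bound hx

theorem phiGen_ode {x : ℝ} (hx : |x| < 1) :
    4 * x * (1 - x) * phiGenDerivTwo x + 2 * (1 - 2 * x) * phiGenDeriv x
      = 4 / 9 * (2 - phiGen x) := by
  have h0 : HasSum (fun n : ℕ => phiSeq n * x ^ n) (phiGen x) :=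
    (summable_mul_pow_of_abs_le phiSeq_coeff_bound hx).hasSum
  have h1 : HasSum (fun n : ℕ => ((n : ℝ) + 1) * phiSeq (n + 1) * x ^ n) (phiGenDeriv x) :=
    (summable_mul_pow_of_abs_le phiSeq_deriv_coeff_bound hx).hasSum
  have h2 : HasSum (fun n : ℕ =>
      ((n : ℝ) + 1) * ((((n + 1 : ℕ) : ℝ) + 1) * phiSeq (n + 1 + 1)) * x ^ n)
      (phiGenDerivTwo x) :=
    (summable_mul_pow_of_abs_le phiSeq_deriv_two_coeff_bound hx).hasSum
  have hx1 : HasSum (fun n : ℕ => ((n : ℝ) * phiSeq n) * x ^ n) (x * phiGenDeriv x) :=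
    HasSum.mul_pow_shift (by simpa using h1) (by simp)
  have hx2 : HasSum (fun n : ℕ => ((n : ℝ) * (((n : ℝ) + 1) * phiSeq (n + 1))) * x ^ n)
      (x * phiGenDerivTwo x) :=
    HasSum.mul_pow_shift (by simpa using h2) (by simp)
  have hxx2 : HasSum (fun n : ℕ => (((n : ℝ) - 1) * ((n : ℝ) * phiSeq n)) * x ^ n)
      (x * (x * phiGenDerivTwo x)) :=
    HasSum.mul_pow_shift (by simpa using hx2) (by simp)
  have hc : HasSum (fun n : ℕ => if n = 0 then (8 / 9 : ℝ) else 0) (8 / 9) :=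
    hasSum_ite_eq 0 (8 / 9 : ℝ)
  have hl := (((hx2.mul_left 4).sub (hxx2.mul_left 4)).add (h1.mul_left 2)).sub
    (hx1.mul_left 4)
  have hr := hc.sub (h0.mul_left (4 / 9))
  have hterm : ∀ n : ℕ, 4 * ((n : ℝ) * (((n : ℝ) + 1) * phiSeq (n + 1)) * x ^ n)
      - 4 * (((n : ℝ) - 1) * ((n : ℝ) * phiSeq n) * x ^ n)
      + 2 * (((n : ℝ) + 1) * phiSeq (n + 1) * x ^ n) - 4 * ((n : ℝ) * phiSeq n * x ^ n)
      = (if n = 0 then (8 / 9 : ℝ) else 0) - 4 / 9 * (phiSeq n * x ^ n) := by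
    intro n
    have hrec := phiSeq_recurrence n
    have hite : (if n = 0 then (8 / 9 : ℝ) else 0) * x ^ n = if n = 0 then 8 / 9 else 0 := by
      split_ifs with hn <;> simp [hn]
    linear_combination x ^ n * hrec + hite
  simp only [hterm] at hl
  have key := hl.unique hr
  linear_combination key

theorem phiGen_sin_sq {θ : ℝ} (h0 : 0 ≤ θ) (hθ : θ < Real.pi / 2) :
    phiGen (Real.sin θ ^ 2) = 2 - 2 * Real.cos (2 / 3 * θ) := by
  have hlt : ∀ t ∈ Set.Icc 0 θ, |Real.sin t ^ 2| < 1 := by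
    intro t ht
    have hc : 0 < Real.cos t :=
      Real.cos_pos_of_mem_Ioo ⟨by linarith [ht.1, Real.pi_pos], by linarith [ht.2]⟩
    rw [abs_of_nonneg (sq_nonneg _)]
    nlinarith [Real.sin_sq_add_cos_sq t]
  have hsq : ∀ t, HasDerivAt (fun t => Real.sin t ^ 2) (2 * Real.sin t * Real.cos t) t := by
    intro t
    refine ((Real.hasDerivAt_sin t).pow 2).congr_deriv ?_
    norm_num
  have hG : ∀ t ∈ Set.Icc 0 θ, HasDerivAt (fun t => 2 - phiGen (Real.sin t ^ 2))
      (-(phiGenDeriv (Real.sin t ^ 2) * (2 * Real.sin t * Real.cos t))) t := fun t ht =>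
    (HasDerivAt.comp t (hasDerivAt_phiGen (hlt t ht)) (hsq t)).const_sub 2
  have hH : ∀ t ∈ Set.Icc 0 θ,
      HasDerivAt (fun t => -(phiGenDeriv (Real.sin t ^ 2) * (2 * Real.sin t * Real.cos t)))
      (-(4 / 9) * (2 - phiGen (Real.sin t ^ 2))) t := by
    intro t ht
    have h := (((hasDerivAt_phiGenDeriv (hlt t ht)).comp t (hsq t)).mul
      (((Real.hasDerivAt_sin t).const_mul 2).mul (Real.hasDerivAt_cos t))).neg
    refine h.congr_deriv ?_
    have ode := phiGen_ode (hlt t ht)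
    have hcs := Real.cos_sq' t
    simp only [Function.comp_apply, Pi.mul_apply]
    linear_combination (-1) * ode - (4 * Real.sin t ^ 2 * phiGenDerivTwo (Real.sin t ^ 2)
      + 2 * phiGenDeriv (Real.sin t ^ 2)) * hcs
  have hcos : ∀ t : ℝ, HasDerivAt (fun t => Real.cos (2 / 3 * t))
      (-Real.sin (2 / 3 * t) * (2 / 3)) t := fun t => by
    simpa using ((hasDerivAt_id t).const_mul (2 / 3 : ℝ)).cos
  have hsin : ∀ t : ℝ, HasDerivAt (fun t => Real.sin (2 / 3 * t))
      (Real.cos (2 / 3 * t) * (2 / 3)) t := fun t => by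
    simpa using ((hasDerivAt_id t).const_mul (2 / 3 : ℝ)).sin
  have hconst : ∀ f : ℝ → ℝ, (∀ t ∈ Set.Icc 0 θ, HasDerivAt f 0 t) → f θ = f 0 := fun f hf =>
    constant_of_has_deriv_right_zero (fun t ht => (hf t ht).continuousAt.continuousWithinAt)
      (fun t ht => (hf t ⟨ht.1, ht.2.le⟩).hasDerivWithinAt) θ ⟨h0, le_rfl⟩
  have hP := hconst _ fun t ht => (((hG t ht).mul (hcos t)).sub
    (((hH t ht).mul (hsin t)).const_mul (3 / 2))).congr_deriv (by ring)
  have hQ := hconst _ fun t ht => (((hG t ht).mul (hsin t)).add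
    (((hH t ht).mul (hcos t)).const_mul (3 / 2))).congr_deriv (by ring)
  have hzero : phiGen 0 = 0 := by
    rw [phiGen, tsum_eq_single 0 fun n hn => by simp [hn]]
    simp [phiSeq]
  simp [hzero] at hP hQ
  have hid := Real.sin_sq_add_cos_sq (2 / 3 * θ)
  linear_combination (-Real.cos (2 / 3 * θ)) * hP - Real.sin (2 / 3 * θ) * hQ
    + (2 - phiGen (Real.sin θ ^ 2)) * hid

theorem stmt_6 (u : ℝ) (hu : u ∈ Set.Ico (0 : ℝ) 1) :
    HasSum (fun n : ℕ => phiSeq n * u ^ n)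
      (4 * Real.sin ((1 / 3) * Real.arcsin (Real.sqrt u)) ^ 2) := by
  obtain ⟨hu0, hu1⟩ := hu
  have hs1 : Real.sqrt u < 1 := by rwa [Real.sqrt_lt' one_pos, one_pow]
  have hsum := (summable_mul_pow_of_abs_le phiSeq_coeff_bound
    (by rwa [abs_of_nonneg hu0] : |u| < 1)).hasSum
  have h := phiGen_sin_sq (Real.arcsin_nonneg.2 (Real.sqrt_nonneg u))
    (Real.arcsin_lt_pi_div_two.2 hs1)
  rw [Real.sin_arcsin (by linarith [Real.sqrt_nonneg u]) hs1.le, Real.sq_sqrt hu0] at h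
  have harg : 2 / 3 * Real.arcsin (Real.sqrt u) = 2 * (1 / 3 * Real.arcsin (Real.sqrt u)) := by
    ring
  rw [harg, Real.cos_two_mul, Real.cos_sq'] at h
  convert hsum using 1
  change _ = phiGen u
  rw [h]
  ring
end
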